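/- arXiv:2311.16382 — 3 statements merged into one kernel-verified Lean document; each statement's English description precedes it below -/
import Mathlib

section
/- The VRS technology set T is an ideal technology if and only if: for each i ∈ {1,…,m} there exists δ ≥ 0 such that (x^min + δ e_i, y^max) ∈ T, and for each r ∈ {1,…,s} there exists δ ≥ 0 such that (x^min, y^max − δ e_r) ∈ T, where e_i, e_r denote the corresponding standard unit vectors. -/
open Finset

noncomputable section

variable {m s n : ℕ}

/-- The VRS technology set generated by data matrices `X`, `Y`. -/
def Tset (X : Matrix (Fin m) (Fin n) ℝ) (Y : Matrix (Fin s) (Fin n) ℝ) :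
    Set ((Fin m → ℝ) × (Fin s → ℝ)) :=
  {p | ∃ lam : Fin n → ℝ, (∀ j, 0 ≤ lam j) ∧ (∑ j, lam j) = 1 ∧
    Matrix.mulVec X lam ≤ p.1 ∧ p.2 ≤ Matrix.mulVec Y lam}

/-- `p` weakly dominates `q`. -/
def WeakDom (p q : (Fin m → ℝ) × (Fin s → ℝ)) : Prop :=
  p.1 ≤ q.1 ∧ q.2 ≤ p.2

/-- `p` dominates `q`. -/
def Dom (p q : (Fin m → ℝ) × (Fin s → ℝ)) : Prop :=
  WeakDom p q ∧ p ≠ q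

/-- A unit is strongly efficient if it lies in `T` and no point of `T` dominates it. -/
def StrongEff (X : Matrix (Fin m) (Fin n) ℝ) (Y : Matrix (Fin s) (Fin n) ℝ)
    (p : (Fin m → ℝ) × (Fin s → ℝ)) : Prop :=
  p ∈ Tset X Y ∧ ∀ q ∈ Tset X Y, ¬ Dom q p

/-- The strongly efficient frontier `∂^S T`. -/
def strongFrontier (X : Matrix (Fin m) (Fin n) ℝ) (Y : Matrix (Fin s) (Fin n) ℝ) :
    Set ((Fin m → ℝ) × (Fin s → ℝ)) :=
  {p | StrongEff X Y p}

/-- The weakly (but not strongly) efficient frontier `∂^W T = ∂T \ ∂^S T`. -/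
def weakFrontier (X : Matrix (Fin m) (Fin n) ℝ) (Y : Matrix (Fin s) (Fin n) ℝ) :
    Set ((Fin m → ℝ) × (Fin s → ℝ)) :=
  frontier (Tset X Y) \ strongFrontier X Y

/-- Componentwise minimum of the input data. -/
def xmin (X : Matrix (Fin m) (Fin n) ℝ) : Fin m → ℝ := fun i => ⨅ j, X i j

/-- Componentwise maximum of the output data. -/
def ymax (Y : Matrix (Fin s) (Fin n) ℝ) : Fin s → ℝ := fun r => ⨆ j, Y r j

/-- The ideal point `(x^min, y^max)`. -/
def idealPoint (X : Matrix (Fin m) (Fin n) ℝ) (Y : Matrix (Fin s) (Fin n) ℝ) :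
    (Fin m → ℝ) × (Fin s → ℝ) :=
  (xmin X, ymax Y)

/-- `T` is an ideal technology: every weakly-but-not-strongly efficient point shares at
least one coordinate with the ideal point. -/
def IdealTech (X : Matrix (Fin m) (Fin n) ℝ) (Y : Matrix (Fin s) (Fin n) ℝ) : Prop :=
  ∀ p ∈ weakFrontier X Y, (∃ i, p.1 i = xmin X i) ∨ (∃ r, p.2 r = ymax Y r)

/-- The upper closure of the convex hull of the columns of `Z`. -/
def upperHull {ι κ : Type*} [Fintype κ] (Z : Matrix ι κ ℝ) : Set (ι → ℝ) :=
  {z | ∃ lam ∈ stdSimplex ℝ κ, Z.mulVec lam ≤ z}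

section UpperHull

variable {ι κ : Type*} [Fintype κ] {Z : Matrix ι κ ℝ}

lemma upperHull_mono {z w : ι → ℝ} (hz : z ∈ upperHull Z) (h : z ≤ w) : w ∈ upperHull Z := by
  obtain ⟨lam, hl, hle⟩ := hz
  exact ⟨lam, hl, hle.trans h⟩

lemma convex_upperHull : Convex ℝ (upperHull Z) := by
  rintro z ⟨l, hl, hz⟩ w ⟨l', hl', hw⟩ a b ha hb hab
  refine ⟨a • l + b • l', convex_stdSimplex ℝ κ hl hl' ha hb hab, ?_⟩
  rw [Matrix.mulVec_add, Matrix.mulVec_smul, Matrix.mulVec_smul]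
  gcongr

open scoped Pointwise in
lemma isClosed_upperHull : IsClosed (upperHull Z) := by
  have h : upperHull Z = Set.Ici 0 + Z.mulVec '' stdSimplex ℝ κ := by
    ext z
    simp only [upperHull, Set.mem_ofPred_eq, Set.mem_add, Set.mem_Ici, Set.exists_mem_image]
    constructor
    · rintro ⟨l, hl, hz⟩
      exact ⟨z - Z.mulVec l, sub_nonneg.2 hz, l, hl, sub_add_cancel _ _⟩
    · rintro ⟨u, hu, l, hl, rfl⟩
      exact ⟨l, hl, le_add_of_nonneg_left hu⟩
  rw [h]
  refine isClosed_Ici.add_right_of_isCompact ((isCompact_stdSimplex ℝ κ).image ?_)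
  exact Continuous.matrix_mulVec continuous_const continuous_id

lemma mem_interior_upperHull [Finite ι] {z w : ι → ℝ} (hz : z ∈ upperHull Z)
    (h : ∀ k, z k < w k) : w ∈ interior (upperHull Z) := by
  refine mem_interior.2 ⟨Set.univ.pi fun k => Set.Ioi (z k), fun v hv => ?_,
    isOpen_set_pi Set.finite_univ fun _ _ => isOpen_Ioi, fun k _ => h k⟩
  exact upperHull_mono hz fun k => (hv k trivial).le

lemma le_mulVec_of_mem_stdSimplex {lam : κ → ℝ} (hl : lam ∈ stdSimplex ℝ κ) {k : ι} {c : ℝ}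
    (hc : ∀ j, c ≤ Z k j) : c ≤ Z.mulVec lam k := by
  calc c = ∑ j, c * lam j := by rw [← Finset.mul_sum, hl.2, mul_one]
    _ ≤ ∑ j, Z k j * lam j :=
      Finset.sum_le_sum fun j _ => mul_le_mul_of_nonneg_right (hc j) (hl.1 j)

lemma mulVec_le_of_mem_stdSimplex {lam : κ → ℝ} (hl : lam ∈ stdSimplex ℝ κ) {k : ι} {c : ℝ}
    (hc : ∀ j, Z k j ≤ c) : Z.mulVec lam k ≤ c := by
  calc ∑ j, Z k j * lam j ≤ ∑ j, c * lam j :=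
      Finset.sum_le_sum fun j _ => mul_le_mul_of_nonneg_right (hc j) (hl.1 j)
    _ = c := by rw [← Finset.mul_sum, hl.2, mul_one]

lemma iInf_le_of_mem_upperHull {z : ι → ℝ} (hz : z ∈ upperHull Z) (k : ι) :
    ⨅ j, Z k j ≤ z k := by
  obtain ⟨lam, hl, hle⟩ := hz
  exact (le_mulVec_of_mem_stdSimplex hl fun j =>
    ciInf_le (Set.finite_range _).bddBelow j).trans (hle k)

/-- A dominated point of `upperHull Z` lying strictly above the ideal point is interior, provided
the hull meets every axis through the ideal point. -/
lemma mem_interior_upperHull_of_lt [Finite ι] [DecidableEq ι] {a p q : ι → ℝ}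
    (ha : ∀ k, ∃ δ : ℝ, 0 ≤ δ ∧ a + δ • (Pi.single k 1 : ι → ℝ) ∈ upperHull Z)
    (hq : q ∈ upperHull Z) (hqp : q < p) (hap : ∀ k, a k < p k) :
    p ∈ interior (upperHull Z) := by
  obtain ⟨hle, l, hl⟩ := Pi.lt_def.1 hqp
  obtain ⟨δ, hδ, hmem⟩ := ha l
  set b := a + δ • (Pi.single l 1 : ι → ℝ) with hb
  obtain ⟨t, ht0, ht1, ht⟩ : ∃ t : ℝ, 0 < t ∧ t ≤ 1 ∧ (1 - t) * q l + t * b l < p l := by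
    have hc : Filter.Tendsto (fun t : ℝ => (1 - t) * q l + t * b l) (nhdsWithin 0 (Set.Ioi 0))
        (nhds (q l)) := by
      have : Continuous fun t : ℝ => (1 - t) * q l + t * b l := by fun_prop
      simpa using (this.tendsto 0).mono_left nhdsWithin_le_nhds
    obtain ⟨t, h1, h2⟩ := ((hc.eventually (gt_mem_nhds hl)).and
      (Ioc_mem_nhdsGT (zero_lt_one' ℝ))).exists
    exact ⟨t, h2.1, h2.2, h1⟩
  refine mem_interior_upperHull
    (convex_upperHull hq hmem (sub_nonneg.2 ht1) ht0.le (sub_add_cancel 1 t)) fun k => ?_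
  simp only [Pi.add_apply, Pi.smul_apply, smul_eq_mul]
  rcases eq_or_ne k l with rfl | hk
  · exact ht
  · have hbk : b k = a k := by simp [hb, hk]
    rw [hbk]
    nlinarith [hle k, hap k]

/-- If the hull misses the `k`-th axis through the ideal point, then some dominated boundary point
lies strictly above the ideal point. -/
lemma exists_mem_frontier_upperHull [Finite ι] [DecidableEq ι] [Nonempty κ] {k : ι}
    (hk : ∀ δ : ℝ, 0 ≤ δ → (fun i => ⨅ j, Z i j) + δ • (Pi.single k 1 : ι → ℝ) ∉ upperHull Z) :
    ∃ p ∈ frontier (upperHull Z), (∃ q ∈ upperHull Z, q < p) ∧ ∀ i, ⨅ j, Z i j < p i := by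
  classical
  set a : ι → ℝ := fun i => ⨅ j, Z i j with ha
  have hab : ∀ i j, a i ≤ Z i j := fun i j => ciInf_le (Set.finite_range _).bddBelow j
  obtain ⟨c, hc⟩ : ∃ c, ∀ j, Z k j ≤ c :=
    (Set.finite_range (Z k)).bddAbove.imp fun c hc j => hc ⟨j, rfl⟩
  have hac : a k ≤ c := (hab k (Classical.arbitrary κ)).trans (hc _)
  set f : ℝ → ι → ℝ := fun t => (a + (c - a k + 1) • (Pi.single k 1 : ι → ℝ)) + fun _ => t with hf
  have hfc : Continuous f := by fun_prop
  set A : Set ℝ := Set.Ici 0 ∩ f ⁻¹' upperHull Z with hA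
  have hAclosed : IsClosed A := isClosed_Ici.inter (isClosed_upperHull.preimage hfc)
  have hAbdd : BddBelow A := ⟨0, fun t ht => ht.1⟩
  have hAne : A.Nonempty := by
    let j₀ := Classical.arbitrary κ
    obtain ⟨M, hM⟩ := (Set.finite_range fun i => Z i j₀ - a i).bddAbove
    refine ⟨max M 0, Set.mem_Ici.2 (le_max_right _ _), Pi.single j₀ 1, single_mem_stdSimplex ℝ j₀,
      fun i => ?_⟩
    have h1 : Z i j₀ - a i ≤ M := hM ⟨i, rfl⟩
    have h2 : 0 ≤ (c - a k + 1) * (Pi.single k 1 : ι → ℝ) i := by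
      refine mul_nonneg (by linarith) ?_
      by_cases h : i = k
      · subst h; simp
      · simp [h]
    have h3 := le_max_left M 0
    simp only [hf, Matrix.mulVec_single_one, Matrix.col_apply, Pi.add_apply, Pi.smul_apply,
      smul_eq_mul]
    linarith
  have htA : sInf A ∈ A := hAclosed.csInf_mem hAne hAbdd
  set t := sInf A with ht
  have ht0 : 0 < t := by
    refine lt_of_le_of_ne htA.1 fun h => hk (c - a k + 1) (by linarith) ?_
    have h2 := htA.2
    rw [← h] at h2
    simpa [hf, ← Pi.zero_def] using h2
  have hap : ∀ i, a i < f t i := fun i => by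
    by_cases h : i = k
    · subst h; simp [hf]; linarith
    · simp [hf, h, ht0]
  refine ⟨f t, ?_, ?_, hap⟩
  · refine ⟨subset_closure htA.2, fun hint => ?_⟩
    have hev : ∀ᶠ u in nhdsWithin t (Set.Iio t), f u ∈ upperHull Z :=
      ((hfc.tendsto t).mono_left nhdsWithin_le_nhds).eventually (mem_interior_iff_mem_nhds.1 hint)
    obtain ⟨u, hu, hu1⟩ := (hev.and (Ico_mem_nhdsLT ht0)).exists
    exact (csInf_le hAbdd (show u ∈ A from ⟨hu1.1, hu⟩)).not_gt hu1.2
  · obtain ⟨lam, hl, hle⟩ := htA.2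
    refine ⟨Z.mulVec lam, ⟨lam, hl, le_rfl⟩, Pi.lt_def.2 ⟨hle, k, ?_⟩⟩
    refine (mulVec_le_of_mem_stdSimplex hl hc).trans_lt ?_
    simp [hf]
    linarith

/-- Every dominated boundary point shares a coordinate with the ideal point iff the hull meets
every axis through the ideal point. -/
theorem frontier_upperHull_ideal_iff [Finite ι] [DecidableEq ι] [Nonempty κ] :
    (∀ p ∈ frontier (upperHull Z), (∃ q ∈ upperHull Z, q < p) → ∃ k, p k = ⨅ j, Z k j) ↔
      ∀ k, ∃ δ : ℝ, 0 ≤ δ ∧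
        (fun i => ⨅ j, Z i j) + δ • (Pi.single k 1 : ι → ℝ) ∈ upperHull Z := by
  constructor
  · intro h k
    by_contra! hk
    obtain ⟨p, hp, hq, hap⟩ := exists_mem_frontier_upperHull hk
    obtain ⟨i, hi⟩ := h p hp hq
    exact (hap i).ne' hi
  · rintro h p hp ⟨q, hq, hqp⟩
    by_contra! hne
    have hpT := isClosed_upperHull.frontier_subset hp
    exact hp.2 (mem_interior_upperHull_of_lt h hq hqp fun k =>
      (iInf_le_of_mem_upperHull hpT k).lt_of_ne' (hne k))

end UpperHull

/-- The homeomorphism `(x, y) ↦ (x, -y)` onto the vectors indexed by inputs and outputs. -/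
def stackHomeo (m s : ℕ) : (Fin m → ℝ) × (Fin s → ℝ) ≃ₜ (Fin m ⊕ Fin s → ℝ) :=
  ((Homeomorph.refl (Fin m → ℝ)).prodCongr (Homeomorph.neg (Fin s → ℝ))).trans
    Homeomorph.sumArrowHomeomorphProdArrow.symm

@[simp] lemma stackHomeo_inl (p : (Fin m → ℝ) × (Fin s → ℝ)) (i : Fin m) :
    stackHomeo m s p (Sum.inl i) = p.1 i := rfl

@[simp] lemma stackHomeo_inr (p : (Fin m → ℝ) × (Fin s → ℝ)) (r : Fin s) :
    stackHomeo m s p (Sum.inr r) = -p.2 r := rfl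

lemma stackHomeo_le_iff {p q : (Fin m → ℝ) × (Fin s → ℝ)} :
    stackHomeo m s p ≤ stackHomeo m s q ↔ WeakDom p q := by
  simp [WeakDom, Pi.le_def]

lemma stackHomeo_lt_iff {p q : (Fin m → ℝ) × (Fin s → ℝ)} :
    stackHomeo m s p < stackHomeo m s q ↔ Dom p q := by
  rw [lt_iff_le_and_ne, stackHomeo_le_iff, (stackHomeo m s).injective.ne_iff, Dom]

lemma Tset_eq_preimage (X : Matrix (Fin m) (Fin n) ℝ) (Y : Matrix (Fin s) (Fin n) ℝ) :
    Tset X Y = stackHomeo m s ⁻¹' upperHull (X.fromRows (-Y)) := by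
  ext p
  simp [Tset, upperHull, stdSimplex, Pi.le_def, Matrix.fromRows_mulVec, Matrix.neg_mulVec,
    and_assoc]

lemma stackHomeo_idealPoint (X : Matrix (Fin m) (Fin n) ℝ) (Y : Matrix (Fin s) (Fin n) ℝ) :
    stackHomeo m s (idealPoint X Y) = fun k => ⨅ j, X.fromRows (-Y) k j := by
  ext (i | r)
  · simp [idealPoint, xmin]
  · simp only [stackHomeo_inr, idealPoint, ymax, Matrix.fromRows_apply_inr, Matrix.neg_apply]
    rw [iSup, iInf, ← Real.sInf_neg, ← Set.image_neg_eq_neg, ← Set.range_comp, Function.comp_def]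

/-- `T` is an ideal technology iff for each coordinate there is a point of
`T` coinciding with the ideal point except perhaps in that coordinate. -/
theorem stmt15 (hn : 0 < n) (X : Matrix (Fin m) (Fin n) ℝ)
    (Y : Matrix (Fin s) (Fin n) ℝ) :
    IdealTech X Y ↔
      (∀ i : Fin m, ∃ δ : ℝ, 0 ≤ δ ∧
        (xmin X + δ • (Pi.single i 1 : Fin m → ℝ), ymax Y) ∈ Tset X Y) ∧
      (∀ r : Fin s, ∃ δ : ℝ, 0 ≤ δ ∧
        (xmin X, ymax Y - δ • (Pi.single r 1 : Fin s → ℝ)) ∈ Tset X Y) := by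
  have : Nonempty (Fin n) := ⟨⟨0, hn⟩⟩
  have key := frontier_upperHull_ideal_iff (Z := X.fromRows (-Y))
  have hφ := stackHomeo_idealPoint X Y
  have hin : ∀ (i : Fin m) (δ : ℝ),
      stackHomeo m s (xmin X + δ • (Pi.single i 1 : Fin m → ℝ), ymax Y) =
        (fun k => ⨅ j, X.fromRows (-Y) k j) + δ • Pi.single (Sum.inl i) 1 := by
    intro i δ
    rw [← hφ]
    ext (i' | r) <;> simp [idealPoint, Pi.single_apply]
  have hout : ∀ (r : Fin s) (δ : ℝ),
      stackHomeo m s (xmin X, ymax Y - δ • (Pi.single r 1 : Fin s → ℝ)) =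
        (fun k => ⨅ j, X.fromRows (-Y) k j) + δ • Pi.single (Sum.inr r) 1 := by
    intro r δ
    rw [← hφ]
    ext (i | r') <;> simp [idealPoint, Pi.single_apply]
    ring
  have hideal : IdealTech X Y ↔ ∀ p ∈ frontier (upperHull (X.fromRows (-Y))),
      (∃ q ∈ upperHull (X.fromRows (-Y)), q < p) → ∃ k, p k = ⨅ j, X.fromRows (-Y) k j := by
    rw [(stackHomeo m s).surjective.forall]
    refine forall_congr' fun p => ?_
    have hw : p ∈ weakFrontier X Y ↔ stackHomeo m s p ∈ frontier (upperHull (X.fromRows (-Y))) ∧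
        ∃ q ∈ upperHull (X.fromRows (-Y)), q < stackHomeo m s p := by
      have hcl : p ∈ frontier (Tset X Y) → p ∈ Tset X Y := by
        rw [Tset_eq_preimage]
        exact fun h =>
          (isClosed_upperHull.preimage (stackHomeo m s).continuous).frontier_subset h
      rw [← Set.mem_preimage, (stackHomeo m s).preimage_frontier, ← Tset_eq_preimage,
        (stackHomeo m s).surjective.exists]
      simp only [stackHomeo_lt_iff, ← Set.mem_preimage (f := stackHomeo m s), ← Tset_eq_preimage]
      simp only [weakFrontier, strongFrontier, StrongEff, Set.mem_sdiff, Set.mem_ofPred_eq]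
      grind
    have hk : (∃ k, stackHomeo m s p k = ⨅ j, X.fromRows (-Y) k j) ↔
        (∃ i, p.1 i = xmin X i) ∨ ∃ r, p.2 r = ymax Y r := by
      simp only [← congrFun hφ, Sum.exists, stackHomeo_inl, stackHomeo_inr, idealPoint, neg_inj]
    rw [hw, hk, and_imp]
  rw [hideal, key, Sum.forall]
  simp only [Tset_eq_preimage, Set.mem_preimage, hin, hout]

end
end

section
/- Let a GS path-based model on the VRS technology set T be given and let (x_o,y_o) ∈ T have efficiency score θ*_o. The projection φ_o(θ*_o) is strongly efficient if and only if every optimal solution (λ*, θ*_o) of the model's programme (i.e., every λ* ∈ ℝ^n with λ* ≥ 0, ∑_j λ*_j = 1, Xλ* ≤ φ^x_o(θ*_o) and Yλ* ≥ φ^y_o(θ*_o)) satisfies the constraints with equality: Xλ* = φ^x_o(θ*_o) and Yλ* = φ^y_o(θ*_o). -/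
open Finset

noncomputable section

variable {m s n : ℕ}

/-- The pair of path-generating functions `ψ^x, ψ^y` of a GS path-based model, together
with their domains and the standing assumptions (A1)–(A4). -/
structure GSPsi where
  ψx : ℝ → ℝ
  ψy : ℝ → ℝ
  Dx : Set ℝ
  Dy : Set ℝ
  hDx : Dx = Set.univ ∨ Dx = Set.Ioi (0 : ℝ)
  hDy : Dy = Set.univ ∨ Dy = Set.Ioi (0 : ℝ)
  hψx_diff : DifferentiableOn ℝ ψx Dx
  hψy_diff : DifferentiableOn ℝ ψy Dy
  hψx_conc : ConcaveOn ℝ Dx ψx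
  hψy_conv : ConvexOn ℝ Dy ψy
  hψx_mono : StrictMonoOn ψx Dx
  hψy_anti : StrictAntiOn ψy Dy
  hone_x : (1 : ℝ) ∈ Dx
  hone_y : (1 : ℝ) ∈ Dy
  hψx_one : ψx 1 = 1
  hψy_one : ψy 1 = 1
  himx : ψx '' Dx = Set.univ ∨ ψx '' Dx = Set.Ioi (0 : ℝ)
  himy : ψy '' Dy = Set.univ ∨ ψy '' Dy = Set.Ioi (0 : ℝ)

/-- The common domain `D = dom ψ^x ∩ dom ψ^y`. -/
def GSPsi.D (P : GSPsi) : Set ℝ := P.Dx ∩ P.Dy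

/-- A GS path-based model: path-generating functions plus a direction assignment. -/
structure GSModel (X : Matrix (Fin m) (Fin n) ℝ) (Y : Matrix (Fin s) (Fin n) ℝ)
    extends GSPsi where
  g : (Fin m → ℝ) × (Fin s → ℝ) → (Fin m → ℝ) × (Fin s → ℝ)
  hg_nonneg : ∀ p ∈ Tset X Y, 0 ≤ (g p).1 ∧ 0 ≤ (g p).2
  hg_ne : ∀ p ∈ Tset X Y, g p ≠ 0

variable {X : Matrix (Fin m) (Fin n) ℝ} {Y : Matrix (Fin s) (Fin n) ℝ}

/-- Input component of the path `φ_o`. -/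
def GSModel.pathx (M : GSModel X Y) (p : (Fin m → ℝ) × (Fin s → ℝ)) (θ : ℝ) :
    Fin m → ℝ :=
  p.1 + (M.ψx θ - 1) • (M.g p).1

/-- Output component of the path `φ_o`. -/
def GSModel.pathy (M : GSModel X Y) (p : (Fin m → ℝ) × (Fin s → ℝ)) (θ : ℝ) :
    Fin s → ℝ :=
  p.2 + (M.ψy θ - 1) • (M.g p).2

/-- The path `φ_o(θ)`. -/
def GSModel.path (M : GSModel X Y) (p : (Fin m → ℝ) × (Fin s → ℝ)) (θ : ℝ) :
    (Fin m → ℝ) × (Fin s → ℝ) :=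
  (M.pathx p θ, M.pathy p θ)

/-- `θ` is feasible for the unit `p` in the programme `(GS)_o`. -/
def GSModel.feasible (M : GSModel X Y) (p : (Fin m → ℝ) × (Fin s → ℝ)) (θ : ℝ) :
    Prop :=
  θ ∈ M.toGSPsi.D ∧ ∃ lam : Fin n → ℝ, (∀ j, 0 ≤ lam j) ∧ (∑ j, lam j) = 1 ∧
    Matrix.mulVec X lam ≤ M.pathx p θ ∧ M.pathy p θ ≤ Matrix.mulVec Y lam

/-- The path-flow mapping `Φ_θ` is monotone on `T`. -/
def GSModel.flowMono (M : GSModel X Y) (θ : ℝ) : Prop :=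
  ∀ p ∈ Tset X Y, ∀ q ∈ Tset X Y, WeakDom p q → WeakDom (M.path p θ) (M.path q θ)

/-- The path-flow mapping `Φ_θ` is strictly monotone on `T`. -/
def GSModel.flowStrictMono (M : GSModel X Y) (θ : ℝ) : Prop :=
  M.flowMono θ ∧
    ∀ p ∈ Tset X Y, ∀ q ∈ Tset X Y, Dom p q → Dom (M.path p θ) (M.path q θ)

/-- the projection of a unit is strongly efficient iff every optimal
solution of the programme satisfies the constraints with equality. -/
theorem stmt17 (M : GSModel X Y)
    (score : ((Fin m → ℝ) × (Fin s → ℝ)) → ℝ)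
    (hscore : ∀ p ∈ Tset X Y, IsLeast {θ | M.feasible p θ} (score p))
    (p : (Fin m → ℝ) × (Fin s → ℝ)) (hp : p ∈ Tset X Y) :
    StrongEff X Y (M.path p (score p)) ↔
      ∀ lam : Fin n → ℝ, (∀ j, 0 ≤ lam j) → (∑ j, lam j) = 1 →
        Matrix.mulVec X lam ≤ M.pathx p (score p) →
        M.pathy p (score p) ≤ Matrix.mulVec Y lam →
        Matrix.mulVec X lam = M.pathx p (score p) ∧
          Matrix.mulVec Y lam = M.pathy p (score p) := by
  constructor
  · rintro ⟨-, hmax⟩ lam hnonneg hsum hx hy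
    by_contra hne
    refine hmax (Matrix.mulVec X lam, Matrix.mulVec Y lam)
      ⟨lam, hnonneg, hsum, le_rfl, le_rfl⟩ ⟨⟨hx, hy⟩, fun h => hne ?_⟩
    exact Prod.mk.inj h
  · intro heq
    refine ⟨(hscore p hp).1.2, ?_⟩
    rintro q ⟨lam, hnonneg, hsum, hx, hy⟩ ⟨⟨hqx, hqy⟩, hne⟩
    obtain ⟨hX, hY⟩ := heq lam hnonneg hsum (hx.trans hqx) (hqy.trans hy)
    exact hne (Prod.ext (hqx.antisymm (hX.symm.trans_le hx)) ((hy.trans_eq hY).antisymm hqy))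

end
end

section
/- Let T be the VRS technology set and let (x̄,ȳ) ∈ T. Suppose there exist u ∈ ℝ^s with u > 0 componentwise, v ∈ ℝ^m with v > 0 componentwise, and σ ∈ ℝ such that u^T y − v^T x ≤ σ for all (x,y) ∈ T and u^T ȳ − v^T x̄ = σ. Then (x̄,ȳ) is strongly efficient. -/
open Finset

noncomputable section

variable {m s n : ℕ}

/-- A positively weighted sum is strictly increasing in its entries: a vector below another
one with at least the same weighted sum equals it. -/
theorem eq_of_le_of_weighted_sum_le {ι : Type*} [Fintype ι] {w a b : ι → ℝ}
    (hw : ∀ i, 0 < w i) (hab : a ≤ b) (h : ∑ i, w i * b i ≤ ∑ i, w i * a i) : a = b := by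
  have hle : ∀ i ∈ univ, w i * a i ≤ w i * b i := fun i _ =>
    mul_le_mul_of_nonneg_left (hab i) (hw i).le
  have heq := (sum_eq_sum_iff_of_le hle).1 (le_antisymm (sum_le_sum hle) h)
  exact funext fun i => mul_left_cancel₀ (hw i).ne' (heq i (mem_univ i))

/-- a unit of `T` at which a supporting hyperplane with positive normal
coefficients attains its bound is strongly efficient. -/
theorem stmt19 (X : Matrix (Fin m) (Fin n) ℝ) (Y : Matrix (Fin s) (Fin n) ℝ)
    (p : (Fin m → ℝ) × (Fin s → ℝ)) (hp : p ∈ Tset X Y)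
    (u : Fin s → ℝ) (v : Fin m → ℝ) (σ : ℝ)
    (hu : ∀ r, 0 < u r) (hv : ∀ i, 0 < v i)
    (hsep : ∀ q ∈ Tset X Y, (∑ r, u r * q.2 r) - (∑ i, v i * q.1 i) ≤ σ)
    (heq : (∑ r, u r * p.2 r) - (∑ i, v i * p.1 i) = σ) :
    StrongEff X Y p := by
  refine ⟨hp, ?_⟩
  rintro q hq ⟨⟨hx, hy⟩, hne⟩
  have hq_le := hsep q hq
  have hvx : ∑ i, v i * q.1 i ≤ ∑ i, v i * p.1 i :=
    sum_le_sum fun i _ => mul_le_mul_of_nonneg_left (hx i) (hv i).le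
  have huy : ∑ r, u r * p.2 r ≤ ∑ r, u r * q.2 r :=
    sum_le_sum fun r _ => mul_le_mul_of_nonneg_left (hy r) (hu r).le
  exact hne (Prod.ext (eq_of_le_of_weighted_sum_le hv hx (by linarith))
    (eq_of_le_of_weighted_sum_le hu hy (by linarith)).symm)

end
end
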